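/- arXiv:2209.04740 — 2 statements merged into one kernel-verified Lean document; each statement's English description precedes it below -/
import Mathlib

section
/- Let W_2 ⊆ {0,1}^3 be the configuration consisting of two vertices of Q_3 at Hamming distance 2, e.g. W_2 = {(0,0,0),(0,1,1)}. Then λ(W_2,3) = 3/4. -/
open Filter

namespace CubeDensity

/-- The automorphism of `Q_d` given by permuting coordinates by `σ` and then
complementing the values in the coordinates where `ε` is `true`. -/
def autMap (d : ℕ) (σ : Equiv.Perm (Fin d)) (ε : Fin d → Bool) (v : Fin d → Bool) :
    Fin d → Bool :=
  fun i => xor (v (σ⁻¹ i)) (ε i)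

/-- `K` is an exact copy of `H` in `Q_d`: some automorphism of `Q_d` maps `H` onto `K`. -/
def ExactCopy (d : ℕ) (H K : Set (Fin d → Bool)) : Prop :=
  ∃ σ : Equiv.Perm (Fin d), ∃ ε : Fin d → Bool, autMap d σ ε '' H = K

/-- The vertex of `Q_n` in the sub-`d`-cube with flip coordinates `F` (and fixed values `g`
outside `F`) corresponding to the vertex `u` of `Q_d`, identifying the flip coordinates
with `Fin d` in increasing order. -/
def embed {n d : ℕ} (F : Finset (Fin n)) (hF : F.card = d) (g : Fin n → Bool)
    (u : Fin d → Bool) : Fin n → Bool :=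
  fun i => if h : i ∈ F then u ((F.orderIsoOfFin hF).symm ⟨i, h⟩) else g i

/-- The sub-`d`-cube of `Q_n` with flip coordinates `F` and fixed values `g` outside `F`
is `H`-good for `S`: the configuration induced by `S` on it is an exact copy of `H`. -/
def IsGood {n d : ℕ} (H : Set (Fin d → Bool)) (S : Set (Fin n → Bool))
    (F : Finset (Fin n)) (hF : F.card = d) (g : Fin n → Bool) : Prop :=
  ExactCopy d H {u : Fin d → Bool | embed F hF g u ∈ S}

/-- The number of `H`-good sub-`d`-cubes of `Q_n`, where a sub-`d`-cube is encoded as a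
pair `(F, g)` with `F` the `d`-element set of flip coordinates and `g` the fixed values
outside `F` (normalized to be `false` on `F`). -/
noncomputable def goodCount (d : ℕ) (H : Set (Fin d → Bool)) (n : ℕ)
    (S : Set (Fin n → Bool)) : ℕ :=
  Nat.card {p : Finset (Fin n) × (Fin n → Bool) //
    ∃ hF : p.1.card = d, (∀ i ∈ p.1, p.2 i = false) ∧ IsGood H S p.1 hF p.2}

/-- `g(H,d,n,S)`: the fraction of the `C(n,d) * 2^(n-d)` sub-`d`-cubes of `Q_n` that are
`H`-good for `S`. -/
noncomputable def gFrac (d : ℕ) (H : Set (Fin d → Bool)) (n : ℕ)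
    (S : Set (Fin n → Bool)) : ℝ :=
  (goodCount d H n S : ℝ) / ((n.choose d : ℝ) * 2 ^ (n - d))

/-- `ex(H,d,n)`: the maximum over all `S ⊆ {0,1}^n` of the fraction of `H`-good
sub-`d`-cubes. -/
noncomputable def exD (d : ℕ) (H : Set (Fin d → Bool)) (n : ℕ) : ℝ :=
  ⨆ S : Set (Fin n → Bool), gFrac d H n S

end CubeDensity
namespace CubeDensity

/-- flip coordinate i -/
def fl {α : Type*} [DecidableEq α] (i : α) (v : α → Bool) : α → Bool :=
  fun x => xor (v x) (decide (x = i))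

theorem fl_fl {α : Type*} [DecidableEq α] (i : α) (v : α → Bool) : fl i (fl i v) = v := by
  funext x; simp [fl]

theorem fl_comm {α : Type*} [DecidableEq α] (i j : α) (v : α → Bool) :
    fl i (fl j v) = fl j (fl i v) := by
  funext x; simp only [fl]; rw [Bool.xor_assoc, Bool.xor_assoc, Bool.xor_comm (decide _)]

theorem fl_of_ne {α : Type*} [DecidableEq α] {i x : α} (v : α → Bool) (h : x ≠ i) :
    fl i v x = v x := by simp [fl, h]

theorem fl_self {α : Type*} [DecidableEq α] {i : α} (v : α → Bool) :
    fl i v i = !v i := by simp [fl]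

theorem fl_ne {α : Type*} [DecidableEq α] (i : α) (v : α → Bool) : fl i v ≠ v := by
  intro h; have := congrFun h i; simp [fl] at this

/-- combinatorial description of good cubes -/
def G {n : ℕ} (S : Set (Fin n → Bool)) (F : Finset (Fin n)) (g : Fin n → Bool)
    (w : Fin n → Bool) (a b c : Fin n) : Prop :=
  a ≠ b ∧ a ≠ c ∧ b ≠ c ∧ F = {a, b, c} ∧ (∀ x, x ∉ F → w x = g x) ∧
  w ∈ S ∧ fl b (fl c w) ∈ S ∧ fl a w ∉ S ∧ fl b w ∉ S ∧ fl c w ∉ S ∧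
  fl a (fl b w) ∉ S ∧ fl a (fl c w) ∉ S ∧ fl a (fl b (fl c w)) ∉ S

abbrev W : Set (Fin 3 → Bool) := {![false, false, false], ![false, true, true]}

theorem fl_embed {n d : ℕ} (F : Finset (Fin n)) (hF : F.card = d) (g : Fin n → Bool)
    (u : Fin d → Bool) (r : Fin d) :
    fl (F.orderIsoOfFin hF r : Fin n) (embed F hF g u) = embed F hF g (fl r u) := by
  funext x
  by_cases hx : x ∈ F
  · simp only [fl, embed, hx, dif_pos]
    congr 1
    rw [decide_eq_decide]
    constructor
    · intro h
      rw [OrderIso.symm_apply_eq]; exact Subtype.ext h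
    · intro h
      rw [OrderIso.symm_apply_eq] at h
      rw [← h]
  · have : x ≠ (F.orderIsoOfFin hF r : Fin n) := by
      rintro rfl; exact hx (Subtype.prop _)
    rw [fl_of_ne _ this]; simp [embed, hx]

theorem aut_image (σ : Equiv.Perm (Fin 3)) (ε : Fin 3 → Bool) :
    autMap 3 σ ε '' W = {ε, fl (σ 1) (fl (σ 2) ε)} := by
  rw [W, Set.image_pair]
  have h1 : autMap 3 σ ε ![false, false, false] = ε := by
    revert σ ε; unfold autMap; decide
  have h2 : autMap 3 σ ε ![false, true, true] = fl (σ 1) (fl (σ 2) ε) := by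
    revert σ ε; unfold autMap fl; decide
  rw [h1, h2]

theorem good_fwd {n : ℕ} {S : Set (Fin n → Bool)} {F : Finset (Fin n)} {hF : F.card = 3}
    {g : Fin n → Bool} (h : IsGood W S F hF g) : ∃ w a b c, G S F g w a b c := by
  obtain ⟨σ, ε, h⟩ := h
  rw [aut_image] at h
  have key : ∀ u, embed F hF g u ∈ S ↔ u = ε ∨ u = fl (σ 1) (fl (σ 2) ε) := by
    intro u
    have := Set.ext_iff.1 h u
    simpa using this.symm
  have inj : ∀ r s : Fin 3, r ≠ s →
      (F.orderIsoOfFin hF (σ r) : Fin n) ≠ F.orderIsoOfFin hF (σ s) := by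
    intro r s hrs h
    exact hrs (σ.injective ((F.orderIsoOfFin hF).injective (Subtype.ext h)))
  refine ⟨embed F hF g ε, F.orderIsoOfFin hF (σ 0), F.orderIsoOfFin hF (σ 1),
    F.orderIsoOfFin hF (σ 2), inj _ _ (by decide), inj _ _ (by decide), inj _ _ (by decide),
    ?_, ?_, ?_⟩
  · symm
    apply Finset.eq_of_subset_of_card_le
    · intro x hx
      simp only [Finset.mem_insert, Finset.mem_singleton] at hx
      rcases hx with rfl | rfl | rfl <;> exact Subtype.prop _
    · rw [hF, Finset.card_eq_three.2 ⟨_, _, _, inj 0 1 (by decide), inj 0 2 (by decide),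
        inj 1 2 (by decide), rfl⟩]
  · intro x hx
    simp [embed, hx]
  · simp only [fl_embed, key]
    clear key inj h
    revert σ ε; unfold fl; decide

theorem good_bwd {n : ℕ} {S : Set (Fin n → Bool)} {F : Finset (Fin n)} {hF : F.card = 3}
    {g : Fin n → Bool} {w a b c} (h : G S F g w a b c) : IsGood W S F hF g := by
  obtain ⟨hab, hac, hbc, hFe, hw, h0, h1, h2, h3, h4, h5, h6, h7⟩ := h
  have ha : a ∈ F := by simp [hFe]
  have hb : b ∈ F := by simp [hFe]
  have hc : c ∈ F := by simp [hFe]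
  set e := F.orderIsoOfFin hF with he
  obtain ⟨a', ha'⟩ := e.surjective ⟨a, ha⟩
  obtain ⟨b', hb'⟩ := e.surjective ⟨b, hb⟩
  obtain ⟨c', hc'⟩ := e.surjective ⟨c, hc⟩
  have ea : (e a' : Fin n) = a := by rw [ha']
  have eb : (e b' : Fin n) = b := by rw [hb']
  have ec : (e c' : Fin n) = c := by rw [hc']
  have dab : a' ≠ b' := by rintro rfl; exact hab (ea.symm.trans eb)
  have dac : a' ≠ c' := by rintro rfl; exact hac (ea.symm.trans ec)
  have dbc : b' ≠ c' := by rintro rfl; exact hbc (eb.symm.trans ec)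
  have hσ : ∃ σ : Equiv.Perm (Fin 3), σ 0 = a' ∧ σ 1 = b' ∧ σ 2 = c' := by
    clear ha' hb' hc' ea eb ec
    revert a' b' c'; decide
  obtain ⟨σ, s0, s1, s2⟩ := hσ
  set ε : Fin 3 → Bool := fun r => w (e r) with hε
  have hwe : w = embed F hF g ε := by
    funext x
    by_cases hx : x ∈ F
    · simp [embed, hx, hε, ← he]
    · simp [embed, hx, hw]
  rw [hwe] at h0 h1 h2 h3 h4 h5 h6 h7
  rw [← ea] at h2 h5 h6 h7
  rw [← eb] at h1 h3 h5 h7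
  rw [← ec] at h1 h4 h6 h7
  simp only [he, fl_embed] at h0 h1 h2 h3 h4 h5 h6 h7
  refine ⟨σ, ε, ?_⟩
  rw [aut_image, s1, s2]
  have cov : ∀ u : Fin 3 → Bool, u = ε ∨ u = fl b' (fl c' ε) ∨ u = fl a' ε ∨ u = fl b' ε ∨
      u = fl c' ε ∨ u = fl a' (fl b' ε) ∨ u = fl a' (fl c' ε) ∨
      u = fl a' (fl b' (fl c' ε)) := by
    have : ∀ (a' b' c' : Fin 3), a' ≠ b' → a' ≠ c' → b' ≠ c' → ∀ δ : Fin 3 → Bool,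
      ∀ u : Fin 3 → Bool, u ∈ [δ, fl b' (fl c' δ), fl a' δ, fl b' δ,
      fl c' δ, fl a' (fl b' δ), fl a' (fl c' δ), fl a' (fl b' (fl c' δ))] := by
      set_option maxRecDepth 100000 in
      decide
    intro u
    simpa using this a' b' c' dab dac dbc ε u
  ext u
  simp only [Set.mem_insert_iff, Set.mem_singleton_iff, Set.mem_ofPred_eq]
  constructor
  · rintro (rfl | rfl) <;> assumption
  · intro hu
    rcases cov u with h | h | h | h | h | h | h | h
    · exact Or.inl h
    · exact Or.inr h
    all_goals (subst h; contradiction)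

theorem choose_three (n : ℕ) : (n.choose 3 : ℝ) = n * (n - 1) * (n - 2) / 6 := by
  induction n with
  | zero => simp
  | succ k ih =>
    rw [Nat.choose_succ_succ', Nat.cast_add, ih, Nat.cast_choose_two]
    push_cast; ring

open Classical in
theorem goodCount_eq {n : ℕ} (S : Set (Fin n → Bool)) :
    goodCount 3 W n S = (Finset.univ.filter (fun p : Finset (Fin n) × (Fin n → Bool) =>
      ∃ hF : p.1.card = 3, (∀ i ∈ p.1, p.2 i = false) ∧ IsGood W S p.1 hF p.2)).card := by
  unfold goodCount
  rw [Nat.card_eq_fintype_card, Fintype.card_subtype]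

/-- both ends of the edge lie outside S -/
def PP {n : ℕ} (S : Set (Fin n → Bool)) (v : Fin n → Bool) (i : Fin n) : Prop :=
  v ∉ S ∧ fl i v ∉ S

/-- exactly one end of the edge lies in S -/
def QQ {n : ℕ} (S : Set (Fin n → Bool)) (v : Fin n → Bool) (i : Fin n) : Prop :=
  ¬ (v ∈ S ↔ fl i v ∈ S)

open Classical in
/-- tuples -/
noncomputable def TT {n : ℕ} (S : Set (Fin n → Bool)) (A : (Fin n → Bool) → Fin n → Prop) :
    Finset (((Fin n → Bool) × Fin n) × (Fin n × Fin n)) :=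
  Finset.univ.filter (fun t => A t.1.1 t.1.2 ∧ PP S (fl t.2.1 t.1.1) t.1.2 ∧
    QQ S (fl t.2.2 t.1.1) t.1.2)

theorem mem_TT {n : ℕ} (S : Set (Fin n → Bool)) (A : (Fin n → Bool) → Fin n → Prop)
    (t : ((Fin n → Bool) × Fin n) × (Fin n × Fin n)) :
    t ∈ TT S A ↔ A t.1.1 t.1.2 ∧ PP S (fl t.2.1 t.1.1) t.1.2 ∧
      QQ S (fl t.2.2 t.1.1) t.1.2 := by
  classical
  simp [TT]

open Classical in
theorem TT_card {n : ℕ} (S : Set (Fin n → Bool)) (A : (Fin n → Bool) → Fin n → Prop) :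
    (TT S A).card ≤ (Finset.univ.filter
      (fun p : (Fin n → Bool) × Fin n => A p.1 p.2)).card * (n ^ 2 / 4) := by
  have hsub : TT S A ⊆ (Finset.univ.filter
      (fun p : (Fin n → Bool) × Fin n => A p.1 p.2)).biUnion (fun p =>
        ({p} : Finset _) ×ˢ ((Finset.univ.filter (fun j => PP S (fl j p.1) p.2)) ×ˢ
          (Finset.univ.filter (fun k => QQ S (fl k p.1) p.2)))) := by
    rintro ⟨⟨v, i⟩, j, k⟩ h
    simpa [TT] using h
  refine (Finset.card_le_card hsub).trans (Finset.card_biUnion_le_card_mul _ _ _ ?_)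
  rintro ⟨v, i⟩ -
  rw [Finset.card_product, Finset.card_product, Finset.card_singleton, one_mul]
  rw [Nat.le_div_iff_mul_le (by norm_num)]
  have hd : Disjoint (Finset.univ.filter (fun j => PP S (fl j v) i))
      (Finset.univ.filter (fun k => QQ S (fl k v) i)) := by
    rw [Finset.disjoint_filter]
    intro x _ h1 h2
    exact h2 (by simp [h1.1, h1.2])
  have hc := Finset.card_le_univ ((Finset.univ.filter (fun j => PP S (fl j v) i)) ∪
      (Finset.univ.filter (fun k => QQ S (fl k v) i)))
  rw [Finset.card_union_of_disjoint hd, Fintype.card_fin] at hc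
  dsimp only
  generalize (Finset.univ.filter (fun j => PP S (fl j v) i)).card = x at *
  generalize (Finset.univ.filter (fun j => QQ S (fl j v) i)).card = y at *
  have h2 : (x + y) ^ 2 ≤ n ^ 2 := Nat.pow_le_pow_left hc 2
  zify at *
  nlinarith [sq_nonneg ((x : ℤ) - y)]

/-- eight tuples from a vertex and directions -/
def eight {n : ℕ} (w : Fin n → Bool) (b c k k' j j' : Fin n) :
    Finset (((Fin n → Bool) × Fin n) × (Fin n × Fin n)) :=
  {((w, b), (j, k)), ((fl b w, b), (j, k)), ((fl c w, b), (j, k)), ((fl b (fl c w), b), (j, k)),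
   ((w, c), (j', k')), ((fl b w, c), (j', k')), ((fl c w, c), (j', k')),
   ((fl b (fl c w), c), (j', k'))}

theorem eight_card {n : ℕ} (w : Fin n → Bool) (b c k k' j j' : Fin n) (h : b ≠ c) :
    (eight w b c k k' j j').card = 8 := by
  have h1 : w ≠ fl b w := (fl_ne _ _).symm
  have h2 : w ≠ fl c w := (fl_ne _ _).symm
  have h3 : w ≠ fl b (fl c w) := by
    intro e; have := congrFun e b; simp [fl, h] at this
  have h4 : fl b w ≠ fl c w := by
    intro e; have := congrFun e b; simp [fl, h] at this
  have h5 : fl b w ≠ fl b (fl c w) := by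
    intro e; have := congrFun e c; simp [fl] at this
  have h6 : fl c w ≠ fl b (fl c w) := (fl_ne _ _).symm
  unfold eight
  repeat rw [Finset.card_insert_of_notMem (by simp [*])]
  rw [Finset.card_singleton]

open Classical in
theorem eight_good {n : ℕ} (S : Set (Fin n → Bool)) (A : (Fin n → Bool) → Fin n → Prop)
    (H : ∀ F g w a b c, G S F g w a b c → ∃ v k k' j j', eight v b c k k' j j' ⊆ TT S A ∧
      (∀ x, x ∉ F → v x = g x) ∧ ({b, j, k} : Finset (Fin n)) = F ∧
        ({c, j', k'} : Finset (Fin n)) = F) :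
    goodCount 3 W n S * 8 ≤ (Finset.univ.filter
      (fun p : (Fin n → Bool) × Fin n => A p.1 p.2)).card * (n ^ 2 / 4) := by
  refine le_trans ?_ (TT_card S A)
  rw [goodCount_eq, ← mul_one (TT S A).card]
  refine Finset.card_mul_le_card_mul
    (fun (p : Finset (Fin n) × (Fin n → Bool))
      (t : ((Fin n → Bool) × Fin n) × (Fin n × Fin n)) =>
      ({t.1.2, t.2.1, t.2.2} : Finset (Fin n)) = p.1 ∧ ∀ x, x ∉ p.1 → t.1.1 x = p.2 x) ?_ ?_
  · rintro ⟨F, g⟩ hp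
    simp only [Finset.mem_filter, Finset.mem_univ, true_and] at hp
    obtain ⟨hF, hg, hgood⟩ := hp
    obtain ⟨w, a, b, c, hG⟩ := good_fwd hgood
    obtain ⟨v, k, k', j, j', h1, h2, h3, h4⟩ := H F g w a b c hG
    rw [← eight_card v b c k k' j j' hG.2.2.1]
    apply Finset.card_le_card
    intro t ht
    rw [Finset.mem_bipartiteAbove]
    refine ⟨h1 ht, ?_⟩
    have hb : b ∈ F := by simp [← h3]
    have hc : c ∈ F := by simp [← h4]
    have e1 : ∀ x, x ∉ F → x ≠ b := by rintro x hx rfl; exact hx hb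
    have e2 : ∀ x, x ∉ F → x ≠ c := by rintro x hx rfl; exact hx hc
    simp only [eight, Finset.mem_insert, Finset.mem_singleton] at ht
    rcases ht with rfl | rfl | rfl | rfl | rfl | rfl | rfl | rfl <;>
    · refine ⟨by assumption, ?_⟩
      intro x hx
      simp [fl_of_ne, e1 x hx, e2 x hx, h2 x hx]
  · rintro t -
    rw [Finset.card_le_one]
    rintro ⟨F, g⟩ h ⟨F', g'⟩ h'
    simp only [Finset.mem_bipartiteBelow, Finset.mem_filter, Finset.mem_univ, true_and] at h h'
    obtain ⟨⟨hF, hg, -⟩, h1, h2⟩ := h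
    obtain ⟨⟨hF', hg', -⟩, h1', h2'⟩ := h'
    have : F = F' := h1.symm.trans h1'
    subst this
    refine Prod.ext rfl (funext fun x => ?_)
    by_cases hx : x ∈ F
    · exact (hg x hx).trans (hg' x hx).symm
    · exact (h2 x hx).symm.trans (h2' x hx)

theorem H_mixed {n : ℕ} (S : Set (Fin n → Bool)) :
    ∀ F g w a b c, G S F g w a b c → ∃ v k k' j j', eight v b c k k' j j' ⊆ TT S (QQ S) ∧
      (∀ x, x ∉ F → v x = g x) ∧ ({b, j, k} : Finset (Fin n)) = F ∧
        ({c, j', k'} : Finset (Fin n)) = F := by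
  rintro F g w a b c ⟨hab, hac, hbc, hFe, hw, h0, h1, h2, h3, h4, h5, h6, h7⟩
  refine ⟨w, c, b, a, a, ?_, hw, ?_, ?_⟩
  · intro t ht
    simp only [eight, Finset.mem_insert, Finset.mem_singleton] at ht
    rcases ht with rfl | rfl | rfl | rfl | rfl | rfl | rfl | rfl <;>
    · rw [mem_TT]
      simp [PP, QQ, fl_comm b a, fl_comm c a, fl_comm c b, fl_fl, h0, h1, h2, h3, h4, h5, h6, h7]
  · rw [hFe]; ext x; simp; tauto
  · rw [hFe]; ext x; simp; tauto

theorem H_zero {n : ℕ} (S : Set (Fin n → Bool)) :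
    ∀ F g w a b c, G S F g w a b c → ∃ v k k' j j', eight v b c k k' j j' ⊆ TT S (PP S) ∧
      (∀ x, x ∉ F → v x = g x) ∧ ({b, j, k} : Finset (Fin n)) = F ∧
        ({c, j', k'} : Finset (Fin n)) = F := by
  rintro F g w a b c ⟨hab, hac, hbc, hFe, hw, h0, h1, h2, h3, h4, h5, h6, h7⟩
  refine ⟨fl a w, a, a, c, b, ?_, ?_, ?_, ?_⟩
  · intro t ht
    simp only [eight, Finset.mem_insert, Finset.mem_singleton] at ht
    rcases ht with rfl | rfl | rfl | rfl | rfl | rfl | rfl | rfl <;>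
    · rw [mem_TT]
      simp [PP, QQ, fl_comm b a, fl_comm c a, fl_comm c b, fl_fl, h0, h1, h2, h3, h4, h5, h6, h7]
  · intro x hx
    rw [fl_of_ne _ (by rintro rfl; simp [hFe] at hx), hw x hx]
  · rw [hFe]; ext x; simp; tauto
  · rw [hFe]; ext x; simp; tauto

open Classical in
theorem upper_nat {n : ℕ} (S : Set (Fin n → Bool)) :
    goodCount 3 W n S * 16 ≤ n * 2 ^ n * (n ^ 2 / 4) := by
  have h1 := eight_good S (QQ S) (H_mixed S)
  have h2 := eight_good S (PP S) (H_zero S)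
  have hd : Disjoint (Finset.univ.filter (fun p : (Fin n → Bool) × Fin n => QQ S p.1 p.2))
      (Finset.univ.filter (fun p : (Fin n → Bool) × Fin n => PP S p.1 p.2)) := by
    rw [Finset.disjoint_filter]
    intro x _ h2 h1
    exact h2 (by simp [h1.1, h1.2])
  have hc := Finset.card_le_univ
    ((Finset.univ.filter (fun p : (Fin n → Bool) × Fin n => QQ S p.1 p.2)) ∪
      (Finset.univ.filter (fun p : (Fin n → Bool) × Fin n => PP S p.1 p.2)))
  rw [Finset.card_union_of_disjoint hd] at hc
  simp only [Fintype.card_prod, Fintype.card_fin, Fintype.card_fun, Fintype.card_bool] at hc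
  have := Nat.mul_le_mul_right (n ^ 2 / 4) hc
  rw [add_mul] at this
  rw [mul_comm n]
  omega

theorem upper_real {n : ℕ} (hn : 3 ≤ n) (S : Set (Fin n → Bool)) :
    gFrac 3 W n S ≤ 3 / 4 * ((n : ℝ) / (n - 1) * (n / (n - 2))) := by
  unfold gFrac
  have h : (goodCount 3 W n S : ℝ) * 16 ≤ n * 2 ^ n * (n ^ 2 / 4) := by
    have h0 := upper_nat S
    have h1 : ((n ^ 2 / 4 : ℕ) : ℝ) ≤ (n : ℝ) ^ 2 / 4 := by
      have := @Nat.cast_div_le ℝ _ _ _ (n ^ 2) 4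
      simpa using this
    have h2 : (goodCount 3 W n S : ℝ) * 16 ≤ n * 2 ^ n * ((n ^ 2 / 4 : ℕ) : ℝ) := by
      exact_mod_cast h0
    exact h2.trans (by gcongr)
  have hp : (2 : ℝ) ^ n = 2 ^ (n - 3) * 8 := by
    rw [show (8 : ℝ) = 2 ^ 3 by norm_num, ← pow_add, Nat.sub_add_cancel hn]
  have hn' : (3 : ℝ) ≤ n := by exact_mod_cast hn
  have p1 : (0 : ℝ) < n - 1 := by linarith
  have p2 : (0 : ℝ) < n - 2 := by linarith
  have p0 : (0 : ℝ) < n := by linarith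
  rw [choose_three, div_le_iff₀ (by positivity)]
  have : 3 / 4 * ((n : ℝ) / (n - 1) * (n / (n - 2))) * (n * (n - 1) * (n - 2) / 6 * 2 ^ (n - 3))
    = n ^ 3 * 2 ^ (n - 3) / 8 := by
    field_simp; ring
  rw [this]
  rw [hp] at h
  nlinarith

open Classical in
/-- parity of number of ones in A -/
noncomputable def par {n : ℕ} (A : Finset (Fin n)) (v : Fin n → Bool) : ZMod 2 :=
  ∑ i ∈ A, if v i then 1 else 0

theorem par_fl {n : ℕ} (A : Finset (Fin n)) (v : Fin n → Bool) (i : Fin n) :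
    par A (fl i v) = par A v + if i ∈ A then 1 else 0 := by
  unfold par
  have : ∀ x, (if fl i v x then (1 : ZMod 2) else 0) =
      (if v x then 1 else 0) + if i = x then 1 else 0 := by
    intro x
    by_cases h : x = i
    · subst h
      cases hv : v x <;> simp [fl, hv] <;> decide
    · simp [fl, h, Ne.symm h]
  simp only [this, Finset.sum_add_distrib, Finset.sum_ite_eq]

/-- extremal set -/
def ES {n : ℕ} (A : Finset (Fin n)) : Set (Fin n → Bool) :=
  {v | par A v = 0 ∧ par Aᶜ v = 0}

theorem ES_good {n : ℕ} (A B F : Finset (Fin n)) (hF : F.card = 3) (g : Fin n → Bool)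
    (hB : B = A ∨ B = Aᶜ)
    {a b c : Fin n} (hab : a ≠ b) (hac : a ≠ c) (hbc : b ≠ c) (hFe : F = {a, b, c})
    (ha : a ∉ B) (hb : b ∈ B) (hc : c ∈ B) : IsGood W (ES A) F hF g := by
  have hES : ∀ v, v ∈ ES A ↔ par B v = 0 ∧ par Bᶜ v = 0 := by
    intro v
    rcases hB with rfl | rfl
    · rfl
    · rw [compl_compl]; exact and_comm
  have hex : ∃ w, (∀ x, x ∉ F → w x = g x) ∧ par B w = 0 ∧ par Bᶜ w = 0 := by
    have h2 : ∀ z : ZMod 2, z = 0 ∨ z = 1 := by decide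
    have h11 : (1 : ZMod 2) + 1 = 0 := by decide
    have na : ∀ x, x ∉ F → x ≠ a := by rintro x hx rfl; simp [hFe] at hx
    have nb : ∀ x, x ∉ F → x ≠ b := by rintro x hx rfl; simp [hFe] at hx
    rcases h2 (par B g) with h | h <;> rcases h2 (par Bᶜ g) with h' | h'
    · exact ⟨g, fun _ _ => rfl, h, h'⟩
    · exact ⟨fl a g, fun x hx => fl_of_ne _ (na x hx), by simp [par_fl, h, ha],
        by simp [par_fl, h', ha, h11]⟩
    · exact ⟨fl b g, fun x hx => fl_of_ne _ (nb x hx), by simp [par_fl, h, hb, h11],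
        by simp [par_fl, h', hb]⟩
    · exact ⟨fl a (fl b g), fun x hx => by rw [fl_of_ne _ (na x hx), fl_of_ne _ (nb x hx)],
        by simp [par_fl, h, ha, hb, h11], by simp [par_fl, h', ha, hb, h11]⟩
  obtain ⟨w, hw, h0, h1⟩ := hex
  have h11 : (1 : ZMod 2) + 1 = 0 := by decide
  refine good_bwd (w := w) (a := a) (b := b) (c := c) ⟨hab, hac, hbc, hFe, hw, ?_⟩
  simp [hES, par_fl, h0, h1, ha, hb, hc, h11]

/-- mixed triples -/
def mixed {n : ℕ} (A : Finset (Fin n)) : Finset (Finset (Fin n)) :=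
  Finset.powersetCard 3 Finset.univ \ (Finset.powersetCard 3 A ∪ Finset.powersetCard 3 Aᶜ)

theorem mixed_good {n : ℕ} (A F : Finset (Fin n)) (h : F ∈ mixed A) (g : Fin n → Bool) :
    ∃ hF : F.card = 3, IsGood W (ES A) F hF g := by
  simp only [mixed, Finset.mem_sdiff, Finset.mem_powersetCard, Finset.mem_union,
    Finset.subset_univ, true_and, not_or, not_and] at h
  obtain ⟨hF, h1, h2⟩ := h
  refine ⟨hF, ?_⟩
  have h1 : ¬ F ⊆ A := fun hh => h1 hh hF
  have h2 : ¬ F ⊆ Aᶜ := fun hh => h2 hh hF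
  obtain ⟨x, y, z, hxy, hxz, hyz, rfl⟩ := Finset.card_eq_three.1 hF
  have e1 : ({x, y, z} : Finset (Fin n)) = {y, x, z} := by ext t; simp; tauto
  have e2 : ({x, y, z} : Finset (Fin n)) = {z, x, y} := by ext t; simp; tauto
  simp only [Finset.insert_subset_iff, Finset.singleton_subset_iff, Finset.mem_compl] at h1 h2
  by_cases hx : x ∈ A <;> by_cases hy : y ∈ A <;> by_cases hz : z ∈ A
  · exact absurd ⟨hx, hy, hz⟩ h1
  · exact ES_good A A _ hF g (Or.inl rfl) hxz.symm hyz.symm hxy e2 hz hx hy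
  · exact ES_good A A _ hF g (Or.inl rfl) hxy.symm hyz hxz e1 hy hx hz
  · exact ES_good A Aᶜ _ hF g (Or.inr rfl) hxy hxz hyz rfl (by simpa) (by simpa) (by simpa)
  · exact ES_good A A _ hF g (Or.inl rfl) hxy hxz hyz rfl hx hy hz
  · exact ES_good A Aᶜ _ hF g (Or.inr rfl) hxy.symm hyz hxz e1 (by simpa) (by simpa) (by simpa)
  · exact ES_good A Aᶜ _ hF g (Or.inr rfl) hxz.symm hyz.symm hxy e2 (by simpa) (by simpa) (by simpa)
  · exact absurd ⟨hx, hy, hz⟩ h2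

theorem gcard {n : ℕ} (F : Finset (Fin n)) (hF : F.card = 3) :
    (Finset.univ.filter (fun g : Fin n → Bool => ∀ i ∈ F, g i = false)).card = 2 ^ (n - 3) := by
  have : (Finset.univ.filter (fun g : Fin n → Bool => ∀ i ∈ F, g i = false)) =
      Fintype.piFinset (fun i => if i ∈ F then ({false} : Finset Bool) else Finset.univ) := by
    ext g
    simp only [Finset.mem_filter, Finset.mem_univ, true_and, Fintype.mem_piFinset]
    refine forall_congr' fun i => ?_
    by_cases h : i ∈ F <;> simp [h]
  rw [this, Fintype.card_piFinset]
  have : ∀ i, (if i ∈ F then ({false} : Finset Bool) else Finset.univ).card =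
      if i ∈ F then 1 else 2 := by
    intro i; by_cases h : i ∈ F <;> simp [h]
  simp only [this]
  rw [Finset.prod_ite]
  simp only [Finset.prod_const, one_pow, one_mul]
  congr 1
  rw [Finset.filter_not, Finset.card_sdiff_of_subset (Finset.filter_subset _ _)]
  simp [hF]

open Classical in
theorem lower_nat {n : ℕ} (A : Finset (Fin n)) :
    (mixed A).card * 2 ^ (n - 3) ≤ goodCount 3 W n (ES A) := by
  rw [goodCount_eq]
  have : (mixed A).card * 2 ^ (n - 3) = ((mixed A).sigma (fun F =>
      Finset.univ.filter (fun g : Fin n → Bool => ∀ i ∈ F, g i = false))).card := by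
    rw [Finset.card_sigma, Finset.sum_const_nat]
    intro F hF
    exact gcard F (mixed_good A F hF (fun _ => false)).1
  rw [this]
  refine Finset.card_le_card_of_injOn (fun p => (p.1, p.2)) ?_ ?_
  · rintro ⟨F, g⟩ h
    simp only [Finset.coe_sigma, Set.mem_sigma_iff, Finset.mem_coe, Finset.mem_filter,
      Finset.mem_univ, true_and] at h ⊢
    obtain ⟨hF, hh⟩ := mixed_good A F h.1 g
    exact ⟨hF, h.2, hh⟩
  · rintro ⟨F, g⟩ _ ⟨F', g'⟩ _ h
    simp only [Prod.mk.injEq] at h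
    obtain ⟨rfl, rfl⟩ := h
    rfl

theorem mixed_card {n : ℕ} (A : Finset (Fin n)) (m : ℕ) (hA : A.card = m) :
    (n.choose 3 : ℝ) - m.choose 3 - (n - m).choose 3 ≤ (mixed A).card := by
  have h := Finset.le_card_sdiff (Finset.powersetCard 3 A ∪ Finset.powersetCard 3 Aᶜ)
    (Finset.powersetCard 3 (Finset.univ : Finset (Fin n)))
  have h2 := Finset.card_union_le (Finset.powersetCard 3 A) (Finset.powersetCard 3 Aᶜ)
  simp only [Finset.card_powersetCard, Finset.card_compl, Finset.card_univ, Fintype.card_fin, hA]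
    at h h2
  have h3 : n.choose 3 ≤ (mixed A).card + m.choose 3 + (n - m).choose 3 := by
    unfold mixed; omega
  have : (n.choose 3 : ℝ) ≤ (mixed A).card + m.choose 3 + (n - m).choose 3 := by exact_mod_cast h3
  linarith

theorem choose_ineq (n : ℕ) : (3 / 4 : ℝ) * n.choose 3 ≤
    (n.choose 3 : ℝ) - (n / 2).choose 3 - (n - n / 2).choose 3 := by
  obtain ⟨m, rfl | rfl⟩ := Nat.even_or_odd' n
  · have e1 : 2 * m / 2 = m := by omega
    have e2 : 2 * m - m = m := by omega
    rw [e1, e2]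
    simp only [choose_three]
    push_cast
    rcases m with _ | m
    · norm_num
    · push_cast
      have : (0 : ℝ) ≤ m := by positivity
      nlinarith [mul_nonneg this this]
  · have e1 : (2 * m + 1) / 2 = m := by omega
    have e2 : 2 * m + 1 - m = m + 1 := by omega
    rw [e1, e2]
    simp only [choose_three]
    push_cast
    rcases m with _ | m
    · norm_num
    · push_cast
      have : (0 : ℝ) ≤ m := by positivity
      nlinarith [mul_nonneg this this]

theorem lower_real {n : ℕ} (hn : 3 ≤ n) : ∃ S : Set (Fin n → Bool), 3 / 4 ≤ gFrac 3 W n S := by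
  obtain ⟨A, -, hA⟩ := Finset.exists_subset_card_eq
    (s := (Finset.univ : Finset (Fin n))) (n := n / 2) (by simp; omega)
  refine ⟨ES A, ?_⟩
  unfold gFrac
  have hpos : (0 : ℝ) < n.choose 3 := by exact_mod_cast Nat.choose_pos hn
  rw [le_div_iff₀ (by positivity)]
  have h1 : ((mixed A).card : ℝ) * 2 ^ (n - 3) ≤ goodCount 3 W n (ES A) := by
    exact_mod_cast lower_nat A
  refine le_trans ?_ h1
  rw [← mul_assoc]
  gcongr
  exact (choose_ineq n).trans (mixed_card A _ hA)

theorem main : Tendsto (fun n => exD 3 W n) atTop (nhds (3 / 4 : ℝ)) := by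
  have hlim : Tendsto (fun n : ℕ => 3 / 4 * ((n : ℝ) / (n - 1) * (n / (n - 2)))) atTop
      (nhds (3 / 4 : ℝ)) := by
    have h1 : ∀ c : ℝ, Tendsto (fun n : ℕ => (n : ℝ) / (n - c)) atTop (nhds 1) := by
      intro c
      have := tendsto_natCast_div_add_atTop (𝕜 := ℝ) (-c)
      simpa [sub_eq_add_neg] using this
    have := ((h1 1).mul (h1 2)).const_mul (3 / 4)
    simpa using this
  refine tendsto_of_tendsto_of_tendsto_of_le_of_le' tendsto_const_nhds hlim ?_ ?_
  · filter_upwards [eventually_ge_atTop 3] with n hn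
    obtain ⟨S, hS⟩ := lower_real hn
    exact hS.trans (le_ciSup (f := fun S => gFrac 3 W n S)
      (Set.finite_range _).bddAbove S)
  · filter_upwards [eventually_ge_atTop 3] with n hn
    exact ciSup_le (fun S => upper_real hn S)

end CubeDensity

/-- λ(W₂, 3) = 3/4, where W₂ = {(0,0,0),(0,1,1)} consists of two vertices of Q₃ at
Hamming distance 2. -/
theorem dCubeDensity_W2 :
    Filter.Tendsto
      (fun n => CubeDensity.exD 3
        ({![false, false, false], ![false, true, true]} : Set (Fin 3 → Bool)) n)
      Filter.atTop (nhds (3 / 4 : ℝ)) := by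
  exact CubeDensity.main
end

section
/- Let W_4 ⊆ {0,1}^3 be the configuration consisting of two adjacent vertices of Q_3, e.g. W_4 = {(0,0,0),(1,0,0)}. Then λ(W_4,3) ≥ 8/27. -/
open Filter

namespace CubeDensity

open Finset in
theorem embed_at {n d : ℕ} (F : Finset (Fin n)) (hF : F.card = d) (g : Fin n → Bool)
    (u : Fin d → Bool) (j : Fin d) : embed F hF g u (F.orderEmbOfFin hF j) = u j := by
  unfold embed
  rw [dif_pos (Finset.orderEmbOfFin_mem F hF j)]
  congr 1
  rw [OrderIso.symm_apply_eq]
  rfl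

theorem embed_out {n d : ℕ} (F : Finset (Fin n)) (hF : F.card = d) (g : Fin n → Bool)
    (u : Fin d → Bool) (i : Fin n) (hi : i ∉ F) : embed F hF g u i = g i := by
  unfold embed
  rw [dif_neg hi]

theorem mem_eq_emb {n d : ℕ} (F : Finset (Fin n)) (hF : F.card = d) (i : Fin n) (hi : i ∈ F) :
    ∃ j, F.orderEmbOfFin hF j = i := by
  have := Finset.range_orderEmbOfFin F hF
  have h : i ∈ Set.range (F.orderEmbOfFin hF) := by rw [this]; exact hi
  exact h

/-- cubes -/
def IsCube (d n : ℕ) (p : Finset (Fin n) × (Fin n → Bool)) : Prop :=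
  p.1.card = d ∧ ∀ i ∈ p.1, p.2 i = false

def Gd (d : ℕ) (H : Set (Fin d → Bool)) (n : ℕ) (S : Set (Fin n → Bool))
    (p : Finset (Fin n) × (Fin n → Bool)) : Prop :=
  ∃ hF : p.1.card = d, (∀ i ∈ p.1, p.2 i = false) ∧ IsGood H S p.1 hF p.2

open Classical in
theorem goodCount_eq_s14 (d : ℕ) (H : Set (Fin d → Bool)) (n : ℕ) (S : Set (Fin n → Bool)) :
    goodCount d H n S = (Finset.univ.filter (Gd d H n S)).card := by
  unfold goodCount
  rw [Nat.card_eq_fintype_card, Fintype.card_subtype]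
  congr 1
  ext p
  simp only [Finset.mem_filter, Finset.mem_univ, true_and, Gd]

open Classical in
theorem card_cubes (d n : ℕ) :
    (Finset.univ.filter (IsCube d n)).card = n.choose d * 2 ^ (n - d) := by
  have h1 : ∀ F : Finset (Fin n), F.card = d →
      (Finset.univ.filter (fun g : Fin n → Bool => ∀ i ∈ F, g i = false)).card = 2 ^ (n - d) := by
    intro F hF
    have : (Finset.univ.filter (fun g : Fin n → Bool => ∀ i ∈ F, g i = false))
        = Fintype.piFinset (fun i => if i ∈ F then {false} else Finset.univ) := by
      ext g
      simp only [Finset.mem_filter, Finset.mem_univ, true_and, Fintype.mem_piFinset]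
      refine forall_congr' fun i => ?_
      by_cases hi : i ∈ F <;> simp [hi]
    rw [this, Fintype.card_piFinset]
    have h2 : ∀ i : Fin n, (if i ∈ F then ({false} : Finset Bool) else Finset.univ).card
        = if i ∈ F then 1 else 2 := by
      intro i; split_ifs <;> simp
    simp only [h2]
    rw [Finset.prod_ite]
    simp only [Finset.prod_const_one, one_mul, Finset.prod_const]
    congr 1
    have : Finset.univ.filter (fun i => i ∉ F) = Fᶜ := by ext; simp
    rw [this, Finset.card_compl, hF, Fintype.card_fin]
  have h3 : Finset.univ.filter (IsCube d n) = (Finset.powersetCard d (Finset.univ : Finset (Fin n))).biUnion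
      (fun F => (Finset.univ.filter (fun g : Fin n → Bool => ∀ i ∈ F, g i = false)).map
        ⟨fun g => (F, g), fun a b h => (Prod.mk.inj h).2⟩) := by
    ext ⟨F, g⟩
    simp only [IsCube, Finset.mem_filter, Finset.mem_univ, true_and, Finset.mem_biUnion,
      Finset.mem_map, Finset.mem_powersetCard, Finset.subset_univ]
    constructor
    · rintro ⟨h, h'⟩
      exact ⟨F, h, g, h', rfl⟩
    · rintro ⟨A, h, g', h', heq⟩
      obtain ⟨rfl, rfl⟩ := Prod.mk.inj heq
      exact ⟨h, h'⟩
  rw [h3, Finset.card_biUnion]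
  · simp only [Finset.card_map]
    rw [Finset.sum_congr rfl (fun F hF => h1 F (Finset.mem_powersetCard.1 hF).2)]
    simp
  · intro F _ F' _ hne
    rw [Function.onFun, Finset.disjoint_left]
    rintro ⟨A, g⟩ h h'
    obtain ⟨a, _, ha⟩ := Finset.mem_map.1 h
    obtain ⟨b, _, hb⟩ := Finset.mem_map.1 h'
    exact hne ((Prod.mk.inj ha).1.trans (Prod.mk.inj hb).1.symm)

theorem gFrac_le_exD (d : ℕ) (H : Set (Fin d → Bool)) (n : ℕ) (S : Set (Fin n → Bool)) :
    gFrac d H n S ≤ exD d H n :=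
  le_ciSup (Set.finite_range _).bddAbove S

theorem gFrac_nonneg (d : ℕ) (H : Set (Fin d → Bool)) (n : ℕ) (S : Set (Fin n → Bool)) :
    0 ≤ gFrac d H n S := by unfold gFrac; positivity

theorem goodCount_le (d : ℕ) (H : Set (Fin d → Bool)) (n : ℕ) (hn : d ≤ n)
    (S : Set (Fin n → Bool)) :
    (goodCount d H n S : ℝ) ≤ exD d H n * ((n.choose d : ℝ) * 2 ^ (n - d)) := by
  have h := gFrac_le_exD d H n S
  have : (0:ℝ) < (n.choose d : ℝ) := by exact_mod_cast Nat.choose_pos hn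
  unfold gFrac at h
  rwa [div_le_iff₀ (by positivity)] at h

/-! Monotonicity -/

def restr {n : ℕ} (S : Set (Fin (n+1) → Bool)) (i : Fin (n+1)) (b : Bool) : Set (Fin n → Bool) :=
  {x | i.insertNth b x ∈ S}

def preF {n : ℕ} (F : Finset (Fin (n+1))) (i : Fin (n+1)) : Finset (Fin n) :=
  Finset.univ.filter (fun j => i.succAbove j ∈ F)

theorem preF_map {n : ℕ} (F : Finset (Fin (n+1))) (i : Fin (n+1)) (hi : i ∉ F) :
    (preF F i).map (Fin.succAboveEmb i) = F := by
  ext k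
  simp only [preF, Finset.mem_map, Finset.mem_filter, Finset.mem_univ, true_and,
    Fin.coe_succAboveEmb]
  constructor
  · rintro ⟨j, hj, rfl⟩; exact hj
  · intro hk
    obtain ⟨j, rfl⟩ := Fin.exists_succAbove_eq (show k ≠ i from fun h => hi (h ▸ hk))
    exact ⟨j, hk, rfl⟩

theorem Gd_restr (d : ℕ) (H : Set (Fin d → Bool)) (n : ℕ) (S : Set (Fin (n+1) → Bool))
    (F : Finset (Fin (n+1))) (g : Fin (n+1) → Bool) (i : Fin (n+1)) (hi : i ∉ F)
    (h : Gd d H (n+1) S (F, g)) :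
    Gd d H n (restr S i (g i)) (preF F i, fun j => g (i.succAbove j)) := by
  obtain ⟨hF, hg, hgood⟩ := h
  simp only at hF hg hgood
  have hF' : (preF F i).card = d := by
    rw [← hF]; conv_rhs => rw [← preF_map F i hi]
    rw [Finset.card_map]
  refine ⟨hF', ?_, ?_⟩
  · intro j hj
    exact hg _ (Finset.mem_filter.1 hj).2
  · have key : ∀ u : Fin d → Bool,
        i.insertNth (g i) (embed (preF F i) hF' (fun j => g (i.succAbove j)) u)
          = embed F hF g u := by
      intro u
      have he : (fun j => i.succAbove ((preF F i).orderEmbOfFin hF' j)) = F.orderEmbOfFin hF := by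
        apply Finset.orderEmbOfFin_unique
        · intro x
          exact (Finset.mem_filter.1 (Finset.orderEmbOfFin_mem (preF F i) hF' x)).2
        · exact (Fin.strictMono_succAbove i).comp (OrderEmbedding.strictMono _)
      funext k
      by_cases hk : k ∈ F
      · obtain ⟨j, rfl⟩ := mem_eq_emb F hF k hk
        rw [embed_at, ← he]
        simp only [Fin.insertNth_apply_succAbove]
        rw [embed_at]
      · rw [embed_out _ _ _ _ _ hk]
        by_cases hki : k = i
        · subst hki; simp
        · obtain ⟨j, rfl⟩ := Fin.exists_succAbove_eq hki
          simp only [Fin.insertNth_apply_succAbove]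
          rw [embed_out]
          intro hj
          exact hk (Finset.mem_filter.1 hj).2
    unfold IsGood at hgood ⊢
    simp only [restr, Set.mem_setOf_eq, key]
    exact hgood

open Classical in
theorem double (d : ℕ) (H : Set (Fin d → Bool)) (n : ℕ) (S : Set (Fin (n+1) → Bool)) :
    goodCount d H (n+1) S * (n + 1 - d) ≤
      ∑ q : Fin (n+1) × Bool, goodCount d H n (restr S q.1 q.2) := by
  simp only [goodCount_eq_s14]
  have h1 : (Finset.univ.filter (Gd d H (n+1) S)).card * (n + 1 - d)
      = ((Finset.univ.filter (Gd d H (n+1) S)).sigma (fun p => p.1ᶜ)).card := by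
    rw [Finset.card_sigma, Finset.sum_const_nat]
    rintro p hp
    obtain ⟨hF, _⟩ := (Finset.mem_filter.1 hp).2
    rw [Finset.card_compl, hF, Fintype.card_fin]
  rw [h1, ← Finset.card_sigma]
  refine Finset.card_le_card_of_injOn
    (fun x => ⟨(x.2, x.1.2 x.2), (preF x.1.1 x.2, fun j => x.1.2 (x.2.succAbove j))⟩) ?_ ?_
  · rintro ⟨⟨F, g⟩, i⟩ hx
    simp only [Finset.coe_sigma, Set.mem_sigma_iff, Finset.mem_coe, Finset.mem_filter,
      Finset.mem_univ, true_and, Finset.mem_compl, Finset.mem_sigma] at hx ⊢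
    exact Gd_restr d H n S F g i hx.2 hx.1
  · rintro ⟨⟨F, g⟩, i⟩ hx ⟨⟨F', g'⟩, i'⟩ hx' heq
    simp only [Finset.mem_coe, Finset.mem_sigma, Finset.mem_compl] at hx hx'
    simp only [Sigma.mk.injEq, Prod.mk.injEq, heq_eq_eq] at heq
    obtain ⟨⟨rfl, hgi⟩, hpF, hg⟩ := heq
    have hFF : F = F' := by rw [← preF_map F i hx.2, hpF, preF_map F' i hx'.2]
    subst hFF
    have : g = g' := by
      funext k
      by_cases hki : k = i
      · subst hki; exact hgi
      · obtain ⟨j, rfl⟩ := Fin.exists_succAbove_eq hki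
        exact congrFun hg j
    subst this
    rfl

theorem exD_succ_le (d : ℕ) (H : Set (Fin d → Bool)) (n : ℕ) (hn : d ≤ n) :
    exD d H (n+1) ≤ exD d H n := by
  refine ciSup_le fun S => ?_
  have hc : (0:ℝ) < (n.choose d : ℝ) := by exact_mod_cast Nat.choose_pos hn
  have hc' : (0:ℝ) < ((n+1).choose d : ℝ) := by exact_mod_cast Nat.choose_pos (by omega)
  unfold gFrac
  rw [div_le_iff₀ (by positivity)]
  have h1 : (goodCount d H (n+1) S : ℝ) * ((n + 1 - d : ℕ) : ℝ) ≤
      ((n:ℝ)+1) * 2 * (exD d H n * ((n.choose d : ℝ) * 2 ^ (n - d))) := by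
    calc (goodCount d H (n+1) S : ℝ) * ((n + 1 - d : ℕ) : ℝ)
        ≤ ∑ q : Fin (n+1) × Bool, (goodCount d H n (restr S q.1 q.2) : ℝ) := by
          exact_mod_cast double d H n S
      _ ≤ ∑ q : Fin (n+1) × Bool, exD d H n * ((n.choose d : ℝ) * 2 ^ (n - d)) :=
          Finset.sum_le_sum fun q _ => goodCount_le d H n hn _
      _ = _ := by simp
  have h2 : (((n+1).choose d : ℕ) : ℝ) * ((n + 1 - d : ℕ) : ℝ) = ((n:ℝ)+1) * (n.choose d : ℝ) := by
    have := Nat.choose_mul_succ_eq n d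
    have h := congrArg (Nat.cast : ℕ → ℝ) this
    push_cast at h
    linarith
  have hpos : (0:ℝ) < ((n + 1 - d : ℕ) : ℝ) := by exact_mod_cast (by omega : 0 < n + 1 - d)
  have h3 : (2:ℝ) ^ (n + 1 - d) = 2 * 2 ^ (n - d) := by
    rw [show n + 1 - d = (n - d) + 1 by omega, pow_succ]; ring
  refine le_of_mul_le_mul_right ?_ hpos
  refine h1.trans (le_of_eq ?_)
  rw [h3]
  calc _ = exD d H n * (2 * 2 ^ (n-d)) * (((n:ℝ)+1) * (n.choose d : ℝ)) := by ring
    _ = _ := by rw [← h2]; ring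

/-! Lower bound -/

abbrev W4 : Set (Fin 3 → Bool) := {![false, false, false], ![true, false, false]}

theorem copy_of (K : Set (Fin 3 → Bool)) (v : Fin 3 → Bool) (j : Fin 3)
    (h : ∀ u, u ∈ K ↔ (u = v ∨ u = Function.update v j (!(v j)))) : ExactCopy 3 W4 K := by
  refine ⟨Equiv.swap 0 j, v, ?_⟩
  rw [Set.image_pair]
  have e1 : autMap 3 (Equiv.swap 0 j) v ![false, false, false] = v := by
    funext i
    have : ∀ k : Fin 3, (![false, false, false] : Fin 3 → Bool) k = false := by decide
    simp [autMap, this]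
  have e2 : autMap 3 (Equiv.swap 0 j) v ![true, false, false]
      = Function.update v j (!(v j)) := by
    funext i
    have : ∀ k : Fin 3, (![true, false, false] : Fin 3 → Bool) k = decide (k = 0) := by decide
    have h2 : ∀ i j : Fin 3, (Equiv.swap 0 j i = 0) ↔ i = j := by decide
    simp only [autMap, this, Equiv.swap_inv, h2, Function.update_apply]
    by_cases hij : i = j
    · subst hij; simp
    · simp [hij]
  rw [e1, e2]
  ext u
  rw [h u]
  simp

def bz (b : Bool) (c : ZMod 3) : ZMod 3 := if b then c else 0

def T0 : Finset (ZMod 3 × ZMod 3 × ZMod 3 × ZMod 3) :=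
  Finset.univ.filter fun x => ∃ v0 v1 v2 : Bool, ∃ f0 f1 f2 : Bool,
    ((f0, f1, f2) = (true, false, false) ∨ (f0, f1, f2) = (false, true, false) ∨
      (f0, f1, f2) = (false, false, true)) ∧ ∀ u0 u1 u2 : Bool,
      (bz u0 x.1 + bz u1 x.2.1 + bz u2 x.2.2.1 = x.2.2.2 ↔
        ((u0, u1, u2) = (v0, v1, v2) ∨ (u0, u1, u2) = (xor v0 f0, xor v1 f1, xor v2 f2)))

theorem card_T0 : T0.card = 24 := by
  decide +kernel

/-- the configuration on the 3-cube -/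
def K3 (c : Fin 3 → ZMod 3) (r : ZMod 3) : Set (Fin 3 → Bool) := {u | ∑ j, bz (u j) (c j) = r}

theorem T0_good (c : Fin 3 → ZMod 3) (r : ZMod 3) (h : (c 0, c 1, c 2, r) ∈ T0) :
    ExactCopy 3 W4 (K3 c r) := by
  obtain ⟨v0, v1, v2, f0, f1, f2, hf, hu⟩ := (Finset.mem_filter.1 h).2
  have hext : ∀ a b : Fin 3 → Bool, a = b ↔ (a 0, a 1, a 2) = (b 0, b 1, b 2) := by
    intro a b
    constructor
    · rintro rfl; rfl
    · intro h
      simp only [Prod.mk.injEq] at h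
      funext i; fin_cases i
      exacts [h.1, h.2.1, h.2.2]
  rcases hf with hf | hf | hf <;> obtain ⟨rfl, rfl, rfl⟩ := (by simpa using hf : _ ∧ _ ∧ _)
  · refine copy_of _ ![v0, v1, v2] 0 fun u => ?_
    simp only [K3, Set.mem_setOf_eq, Fin.sum_univ_three, hext]
    rw [hu]; simp
  · refine copy_of _ ![v0, v1, v2] 1 fun u => ?_
    simp only [K3, Set.mem_setOf_eq, Fin.sum_univ_three, hext]
    rw [hu]; simp
  · refine copy_of _ ![v0, v1, v2] 2 fun u => ?_
    simp only [K3, Set.mem_setOf_eq, Fin.sum_univ_three, hext]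
    rw [hu]; simp

def Sc {n : ℕ} (q : (Fin n → ZMod 3) × ZMod 3) : Set (Fin n → Bool) :=
  {x | ∑ i, bz (x i) (q.1 i) = q.2}

/-- the projection -/
def proj {n : ℕ} (F : Finset (Fin n)) (hF : F.card = 3) (g : Fin n → Bool) :
    ((Fin n → ZMod 3) × ZMod 3) →+ (ZMod 3 × ZMod 3 × ZMod 3 × ZMod 3) where
  toFun q := (q.1 (F.orderEmbOfFin hF 0), q.1 (F.orderEmbOfFin hF 1), q.1 (F.orderEmbOfFin hF 2),
    q.2 - ∑ i ∈ Fᶜ, bz (g i) (q.1 i))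
  map_zero' := by simp [bz]
  map_add' a b := by
    have : ∀ i, bz (g i) (a.1 i + b.1 i) = bz (g i) (a.1 i) + bz (g i) (b.1 i) := by
      intro i; unfold bz; split_ifs <;> simp
    simp only [Prod.fst_add, Prod.snd_add, Pi.add_apply, this, Finset.sum_add_distrib,
      Prod.mk_add_mk, Prod.mk.injEq, true_and]
    ring

theorem proj_surj {n : ℕ} (F : Finset (Fin n)) (hF : F.card = 3) (g : Fin n → Bool) :
    Function.Surjective (proj F hF g) := by
  rintro ⟨a, b, c, r⟩
  refine ⟨(Function.extend (F.orderEmbOfFin hF) ![a, b, c] 0, r), ?_⟩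
  have inj : Function.Injective (F.orderEmbOfFin hF) := (F.orderEmbOfFin hF).injective
  have hz : ∑ i ∈ Fᶜ, bz (g i) (Function.extend (F.orderEmbOfFin hF) ![a, b, c] 0 i) = 0 := by
    apply Finset.sum_eq_zero
    intro i hi
    rw [Function.extend_apply']
    · simp [bz]
    · rintro ⟨j, rfl⟩
      exact (Finset.mem_compl.1 hi) (Finset.orderEmbOfFin_mem F hF j)
  simp only [proj, AddMonoidHom.coe_mk, ZeroHom.coe_mk, hz, inj.extend_apply]
  simp

theorem proj_good {n : ℕ} (F : Finset (Fin n)) (hF : F.card = 3) (g : Fin n → Bool)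
    (q : (Fin n → ZMod 3) × ZMod 3) (h : proj F hF g q ∈ T0) : IsGood W4 (Sc q) F hF g := by
  have := T0_good (fun j => q.1 (F.orderEmbOfFin hF j)) (q.2 - ∑ i ∈ Fᶜ, bz (g i) (q.1 i)) h
  unfold IsGood
  convert this using 1
  ext u
  simp only [Sc, K3, Set.mem_setOf_eq]
  have h1 : ∑ i, bz (embed F hF g u i) (q.1 i) =
      ∑ j, bz (u j) (q.1 (F.orderEmbOfFin hF j)) + ∑ i ∈ Fᶜ, bz (g i) (q.1 i) := by
    rw [← Finset.sum_add_sum_compl F]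
    congr 1
    · have hs : ∀ f : Fin n → ZMod 3, ∑ i ∈ F, f i = ∑ j, f (F.orderEmbOfFin hF j) := by
        intro f
        conv_lhs => rw [← Finset.map_orderEmbOfFin_univ F hF]
        rw [Finset.sum_map]
        rfl
      rw [hs]
      refine Finset.sum_congr rfl fun j _ => ?_
      rw [embed_at]
    · refine Finset.sum_congr rfl fun i hi => ?_
      rw [embed_out _ _ _ _ _ (Finset.mem_compl.1 hi)]
  rw [h1, eq_sub_iff_add_eq]

open Classical in
theorem fib_card {n : ℕ} (F : Finset (Fin n)) (hF : F.card = 3) (g : Fin n → Bool) :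
    (Finset.univ.filter (fun q => proj F hF g q ∈ T0)).card * 81
      = 24 * Fintype.card ((Fin n → ZMod 3) × ZMod 3) := by
  set k := (Finset.univ.filter (fun q => proj F hF g q = 0)).card with hk
  have hfib : ∀ t, (Finset.univ.filter (fun q => proj F hF g q = t)).card = k := by
    intro t
    exact AddMonoidHom.card_fiber_eq_of_mem_range (proj F hF g) (proj_surj F hF g t)
      (proj_surj F hF g 0)
  have h1 : (Finset.univ.filter (fun q => proj F hF g q ∈ T0)).card = 24 * k := by
    rw [Finset.card_eq_sum_card_fiberwise (f := proj F hF g) (t := T0)]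
    · rw [Finset.sum_const_nat (m := k), card_T0]
      intro t ht
      rw [← hfib t]
      congr 1
      ext q
      simp only [Finset.mem_filter, Finset.mem_univ, true_and]
      constructor
      · exact fun h => h.2
      · exact fun h => ⟨h ▸ ht, h⟩
    · intro q hq
      exact (Finset.mem_filter.1 hq).2
  have h2 : Fintype.card ((Fin n → ZMod 3) × ZMod 3) = 81 * k := by
    rw [← Finset.card_univ, Finset.card_eq_sum_card_fiberwise (f := proj F hF g)
      (t := Finset.univ) (by intro q _; simp)]
    rw [Finset.sum_const_nat (m := k) (fun t _ => hfib t)]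
    simp [ZMod.card]
  rw [h1, h2]; ring

open Classical in
theorem sum_ge (n : ℕ) :
    24 * Fintype.card ((Fin n → ZMod 3) × ZMod 3) * (n.choose 3 * 2 ^ (n - 3)) ≤
      (∑ q : (Fin n → ZMod 3) × ZMod 3, goodCount 3 W4 n (Sc q)) * 81 := by
  simp only [goodCount_eq_s14, Finset.card_filter]
  rw [Finset.sum_comm, Finset.sum_mul]
  rw [← card_cubes 3 n, mul_comm, ← smul_eq_mul, ← Finset.sum_const]
  refine (Finset.sum_le_sum ?_).trans
    (Finset.sum_le_sum_of_subset (Finset.filter_subset (IsCube 3 n) Finset.univ))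
  rintro ⟨F, g⟩ hp
  obtain ⟨hF, hg⟩ := (Finset.mem_filter.1 hp).2
  rw [← Finset.card_filter, ← fib_card F hF g]
  refine Nat.mul_le_mul_right _ (Finset.card_le_card ?_)
  intro q hq
  simp only [Finset.mem_filter, Finset.mem_univ, true_and] at hq ⊢
  exact ⟨hF, hg, proj_good F hF g q hq⟩

theorem exD_ge (n : ℕ) (hn : 3 ≤ n) : 8 / 27 ≤ exD 3 W4 n := by
  have h := sum_ge n
  have h' : (24:ℝ) * (Fintype.card ((Fin n → ZMod 3) × ZMod 3) : ℝ) *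
      ((n.choose 3 : ℝ) * 2 ^ (n - 3)) ≤
      (∑ q : (Fin n → ZMod 3) × ZMod 3, (goodCount 3 W4 n (Sc q) : ℝ)) * 81 := by
    exact_mod_cast h
  have h2 : ∑ q : (Fin n → ZMod 3) × ZMod 3, (goodCount 3 W4 n (Sc q) : ℝ) ≤
      (Fintype.card ((Fin n → ZMod 3) × ZMod 3) : ℝ) *
        (exD 3 W4 n * ((n.choose 3 : ℝ) * 2 ^ (n - 3))) := by
    refine (Finset.sum_le_sum fun q _ => goodCount_le 3 W4 n hn (Sc q)).trans (le_of_eq ?_)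
    rw [Finset.sum_const, nsmul_eq_mul, Finset.card_univ]
  have hM : (0:ℝ) < (Fintype.card ((Fin n → ZMod 3) × ZMod 3) : ℝ) := by
    exact_mod_cast Fintype.card_pos
  have hc : (0:ℝ) < (n.choose 3 : ℝ) := by exact_mod_cast Nat.choose_pos hn
  generalize (Fintype.card ((Fin n → ZMod 3) × ZMod 3) : ℝ) = M at *
  have hX : (0:ℝ) < M * ((n.choose 3 : ℝ) * 2 ^ (n - 3)) := by positivity
  refine le_of_mul_le_mul_right ?_ hX
  linarith

end CubeDensity

/-- λ(W₄, 3) ≥ 8/27, where W₄ = {(0,0,0),(1,0,0)} consists of two adjacent vertices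
of Q₃. -/
theorem dCubeDensity_W4_ge :
    ∃ L : ℝ,
      Filter.Tendsto
        (fun n => CubeDensity.exD 3
          ({![false, false, false], ![true, false, false]} : Set (Fin 3 → Bool)) n)
        Filter.atTop (nhds L) ∧ 8 / 27 ≤ L := by
  have hanti : Antitone (fun n => CubeDensity.exD 3 CubeDensity.W4 (n + 3)) :=
    antitone_nat_of_succ_le fun n => by
      have := CubeDensity.exD_succ_le 3 CubeDensity.W4 (n + 3) (by omega)
      rwa [show n + 3 + 1 = n + 1 + 3 by omega] at this
  have hge : ∀ n, 8 / 27 ≤ CubeDensity.exD 3 CubeDensity.W4 (n + 3) :=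
    fun n => CubeDensity.exD_ge (n + 3) (by omega)
  have ht := tendsto_atTop_ciInf hanti ⟨8 / 27, by rintro _ ⟨n, rfl⟩; exact hge n⟩
  exact ⟨_, (tendsto_add_atTop_iff_nat 3).1 ht, le_ciInf hge⟩
end
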